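/- arXiv:1603.02807 — 3 statements merged into one kernel-verified Lean document; each statement's English description precedes it below -/
import Mathlib

section
/- Let v and t be positive integers with v ≤ (t+2)/2. Then an (N,v,t)-suitable core exists if and only if N ≥ v(t+1−v). -/
/-- An `(N,v,t)`-suitable core: an `N × v` array, each of whose rows is a
permutation of `{1,…,v}` (modelled as `Fin v`, with `C i p` the symbol in
position `p` of row `i`), such that for every `s` with `0 ≤ s ≤ t-1`, every
symbol precedes every subset of `s` other symbols in at least `t - s` rows. -/
def IsSuitableCore (N v t : ℕ) (C : Fin N → Equiv.Perm (Fin v)) : Prop :=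
  ∀ s : ℕ, s < t → ∀ σ : Fin v, ∀ S : Finset (Fin v), σ ∉ S → S.card = s →
    t - s ≤ (Finset.univ.filter
      (fun i : Fin N => ∀ τ ∈ S, ((C i).symm σ : ℕ) < ((C i).symm τ : ℕ))).card

/-- A permutation sending `x` to position `0` and (if distinct) `y` to position `1`. -/
theorem exists_perm_first_second (v : ℕ) (x y : Fin v) :
    ∃ Q : Equiv.Perm (Fin v), ((Q x : Fin v) : ℕ) = 0 ∧ (y ≠ x → ((Q y : Fin v) : ℕ) = 1) := by
  have hv : 0 < v := lt_of_le_of_lt (Nat.zero_le _) x.isLt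
  by_cases hxy : y = x
  · exact ⟨Equiv.swap x ⟨0, hv⟩, by simp, fun h => absurd hxy h⟩
  · have h1 : 1 < v := by
      by_contra h
      apply hxy
      ext
      have := x.isLt
      have := y.isLt
      omega
    refine ⟨(Equiv.swap x ⟨0, hv⟩).trans (Equiv.swap (Equiv.swap x ⟨0, hv⟩ y) ⟨1, h1⟩), ?_, ?_⟩
    · have h2 : (⟨0, hv⟩ : Fin v) ≠ Equiv.swap x ⟨0, hv⟩ y := by
        intro h
        have h3 : Equiv.swap x ⟨0, hv⟩ x = Equiv.swap x ⟨0, hv⟩ y := by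
          rw [Equiv.swap_apply_left]; exact h
        exact hxy ((Equiv.injective _ h3).symm)
      rw [Equiv.trans_apply, Equiv.swap_apply_left, Equiv.swap_apply_of_ne_of_ne h2 (by simp)]
    · intro _
      rw [Equiv.trans_apply, Equiv.swap_apply_left]

/-- Pairs `(x, j)` cover all second entries. -/
theorem exists_second (v k : ℕ) (hk : v ≤ k + 1) (hk0 : 0 < k) :
    ∃ (g : Fin v → Fin k → Fin v) (r : Fin v → Fin v → Fin k),
      ∀ x y, y ≠ x → g x (r x y) = y := by
  have key : ∀ x : Fin v, ∃ (g : Fin k → Fin v) (r : Fin v → Fin k),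
      ∀ y, y ≠ x → g (r y) = y := by
    intro x
    have hc : Fintype.card {y : Fin v // y ≠ x} ≤ Fintype.card (Fin k) := by
      have h := Fintype.card_subtype_compl (fun y : Fin v => y = x)
      simp at h
      simp
      omega
    obtain ⟨f⟩ := Function.Embedding.nonempty_of_card_le hc
    refine ⟨Function.extend f (fun y => y.1) (fun _ => x),
      fun y => if h : y ≠ x then f ⟨y, h⟩ else ⟨0, hk0⟩, ?_⟩
    intro y hy
    simp only [dif_pos hy]
    rw [f.injective.extend_apply]
  choose g r h using key
  exact ⟨g, r, h⟩

/-- For `v ≤ (t+2)/2`, an `(N,v,t)`-suitable core exists if and only if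
`N ≥ v(t+1-v)`. -/
theorem exists_suitableCore_iff
    (v t : ℕ) (hv : 0 < v) (ht : 0 < t) (hvt : 2 * v ≤ t + 2)
    (N : ℕ) (hN : 0 < N) :
    (∃ C : Fin N → Equiv.Perm (Fin v), IsSuitableCore N v t C) ↔
      v * (t + 1 - v) ≤ N := by
  have hvt' : v ≤ t := by omega
  constructor
  · rintro ⟨C, hC⟩
    let F : Fin v → Finset (Fin N) := fun σ => Finset.univ.filter
      (fun i : Fin N => ∀ τ ∈ Finset.univ.erase σ,
        ((C i).symm σ : ℕ) < ((C i).symm τ : ℕ))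
    have hF : ∀ σ, t + 1 - v ≤ (F σ).card := by
      intro σ
      have h := hC (v - 1) (by omega) σ (Finset.univ.erase σ) (by simp) (by simp)
      exact le_trans (by omega) h
    have hd : (Finset.univ.biUnion F).card = ∑ σ, (F σ).card := by
      apply Finset.card_biUnion
      intro a _ b _ hab
      rw [Function.onFun, Finset.disjoint_left]
      intro i hi hj
      simp only [F, Finset.mem_filter, Finset.mem_erase, Finset.mem_univ, true_and] at hi hj
      have h1 := hi b ⟨hab.symm, trivial⟩
      have h2 := hj a ⟨hab, trivial⟩
      omega
    calc v * (t + 1 - v) = ∑ _σ : Fin v, (t + 1 - v) := by simp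
      _ ≤ ∑ σ, (F σ).card := Finset.sum_le_sum (fun σ _ => hF σ)
      _ = (Finset.univ.biUnion F).card := hd.symm
      _ ≤ (Finset.univ : Finset (Fin N)).card := Finset.card_le_card (Finset.subset_univ _)
      _ = N := by simp
  · intro hle
    obtain ⟨k, hk⟩ : ∃ k, k = t + 1 - v := ⟨_, rfl⟩
    rw [← hk] at hle
    obtain ⟨g, r, hgr⟩ := exists_second v k (by omega) (by omega)
    choose Q hQ0 hQ1 using exists_perm_first_second v
    obtain ⟨e⟩ : Nonempty ((Fin v × Fin k) ↪ Fin N) :=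
      Function.Embedding.nonempty_of_card_le (by simpa using hle)
    let C : Fin N → Equiv.Perm (Fin v) :=
      Function.extend e (fun p => (Q p.1 (g p.1 p.2)).symm) (fun _ => 1)
    have hCe : ∀ p, C (e p) = (Q p.1 (g p.1 p.2)).symm := fun p => e.injective.extend_apply _ _ _
    refine ⟨C, ?_⟩
    intro s hs σ S hσ hS
    let D : Finset (Fin k ⊕ Fin v) :=
      (Finset.univ : Finset (Fin k)).disjSum (Finset.univ \ insert σ S)
    have hD : D.card = k + (v - (s + 1)) := by
      rw [Finset.card_disjSum, Finset.card_sdiff_of_subset (Finset.subset_univ _),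
        Finset.card_insert_of_notMem hσ, hS]
      simp
    have hDl : t - s ≤ D.card := by
      have : (insert σ S).card ≤ v := by simpa using Finset.card_le_univ (insert σ S)
      omega
    refine le_trans hDl ?_
    let f : Fin k ⊕ Fin v → Fin N :=
      Sum.elim (fun j => e (σ, j)) (fun x => e (x, r x σ))
    apply Finset.card_le_card_of_injOn f
    · intro d hd
      simp only [Finset.coe_filter, Finset.mem_univ, true_and, Set.mem_setOf_eq]
      intro τ hτ
      have hne : τ ≠ σ := fun h => hσ (h ▸ hτ)
      rcases d with j | x
      · simp only [f, Sum.elim_inl, hCe, Equiv.symm_symm]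
        rw [hQ0]
        apply Nat.pos_of_ne_zero
        intro h0
        exact hne ((Q σ (g σ j)).injective (Fin.ext (h0.trans (hQ0 σ (g σ j)).symm)))
      · have hx : x ≠ σ ∧ x ∉ S := by simpa [D] using hd
        simp only [f, Sum.elim_inr, hCe, Equiv.symm_symm, hgr x σ hx.1.symm]
        have h1 := hQ1 x σ hx.1.symm
        have h0 := hQ0 x σ
        have hτx : τ ≠ x := fun h => hx.2 (h ▸ hτ)
        have a0 : ((Q x σ τ : Fin v) : ℕ) ≠ 0 := fun h =>
          hτx ((Q x σ).injective (Fin.ext (h.trans h0.symm)))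
        have a1 : ((Q x σ τ : Fin v) : ℕ) ≠ 1 := fun h =>
          hne ((Q x σ).injective (Fin.ext (h.trans h1.symm)))
        omega
    · intro a ha b hb hab
      rcases a with j | x <;> rcases b with j' | x'
      · simpa [f] using hab
      · have hx : x' ≠ σ ∧ x' ∉ S := by simpa [D] using hb
        have h := e.injective hab
        exact absurd (congrArg Prod.fst h).symm hx.1
      · have hx : x ≠ σ ∧ x ∉ S := by simpa [D] using ha
        have h := e.injective hab
        exact absurd (congrArg Prod.fst h) hx.1
      · have h := e.injective hab
        exact congrArg Sum.inr (congrArg Prod.fst h)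
end

section
/- For each fixed nonnegative integer ℓ, there exists an integer s₀ (depending on ℓ) such that for all integers s ≥ s₀ there does not exist an ((s+1)²+ℓ, s+3, 2s+1)-suitable core. (Combined with Colbourn's construction, this shows SCN(2s+1, (s+1)²+ℓ) = s+2 for all s ≥ s₀.) -/
lemma exists_free {α : Type*} [DecidableEq α] (r K : ℕ) (Q : Finset α) (h : α → α → Finset α)
    (hK : ∀ τ ρ, (h τ ρ).card ≤ K) (hQ : r ^ 3 * (K + 2) < Q.card) :
    ∃ R ⊆ Q, R.card = r ∧ ∀ τ ∈ R, ∀ ρ ∈ R, ∀ x ∈ R, x ≠ τ → x ≠ ρ → x ∉ h τ ρ := by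
  classical
  have hne : Q.Nonempty := Finset.card_pos.mp (by omega)
  obtain ⟨q0, hq0⟩ := hne
  let H : α → α → Finset α := fun τ ρ => h τ ρ ∪ {τ, ρ}
  have hH : ∀ τ ρ, (H τ ρ).card ≤ K + 2 := fun τ ρ =>
    (Finset.card_union_le _ _).trans (Nat.add_le_add (hK τ ρ) Finset.card_le_two)
  let G : Finset (Fin r → α) := Fintype.piFinset (fun _ => Q)
  let bad : Fin r × Fin r × Fin r → Finset (Fin r → α) := fun t =>
    G.filter (fun g => t.2.2 ≠ t.1 ∧ t.2.2 ≠ t.2.1 ∧ g t.2.2 ∈ H (g t.1) (g t.2.1))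
  have hG : G.card = Q.card ^ r := by simp [G]
  have hbad : ∀ t, (bad t).card ≤ (K + 2) * Q.card ^ (r - 1) := by
    rintro ⟨i, j, k⟩
    have h1 : (bad (i, j, k)).card ≤ (K + 2) *
        ((bad (i, j, k)).image (fun g => Function.update g k q0)).card := by
      apply Finset.card_le_mul_card_image
      intro b hb
      obtain ⟨g0, hg0, rfl⟩ := Finset.mem_image.mp hb
      refine le_trans ?_ (hH (g0 i) (g0 j))
      refine Finset.card_le_card_of_injOn (fun g => g k) ?_ ?_
      · intro g hg
        simp only [bad, Finset.coe_filter, Finset.mem_filter, Set.mem_ofPred_eq] at hg hg0 ⊢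
        obtain ⟨⟨_, hki, hkj, hm⟩, he⟩ := hg
        have e1 := congrFun he i
        have e2 := congrFun he j
        simp [Function.update_of_ne hki.symm, Function.update_of_ne hkj.symm] at e1 e2
        simpa [e1, e2] using hm
      · intro g hg g' hg' hgg
        simp only [bad, Finset.coe_filter, Finset.mem_filter, Set.mem_ofPred_eq] at hg hg'
        have he := hg.2.trans hg'.2.symm
        funext x
        by_cases hx : x = k
        · subst hx; exact hgg
        · simpa [Function.update_of_ne hx] using congrFun he x
    refine h1.trans (Nat.mul_le_mul_left _ ?_)
    have h2 : (bad (i, j, k)).image (fun g => Function.update g k q0) ⊆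
        Fintype.piFinset (Function.update (fun _ : Fin r => Q) k {q0}) := by
      intro b hb
      obtain ⟨g0, hg0, rfl⟩ := Finset.mem_image.mp hb
      simp only [bad, G, Finset.mem_filter, Fintype.mem_piFinset] at hg0 ⊢
      intro x
      by_cases hx : x = k
      · subst hx; simp
      · simpa [Function.update_of_ne hx] using hg0.1 x
    refine (Finset.card_le_card h2).trans ?_
    rw [Fintype.card_piFinset]
    rw [← Finset.mul_prod_erase Finset.univ _ (Finset.mem_univ k)]
    rw [Finset.prod_congr rfl (g := fun _ => Q.card)]
    · simp
    · intro x hx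
      rw [Function.update_of_ne (Finset.ne_of_mem_erase hx)]
  have hlt : (Finset.univ.biUnion bad).card < G.card := by
    refine (Finset.card_biUnion_le).trans_lt ?_
    refine (Finset.sum_le_sum (fun t _ => hbad t)).trans_lt ?_
    rw [hG]
    rcases Nat.eq_zero_or_pos r with rfl | hr
    · simp
    · obtain ⟨r', rfl⟩ : ∃ r', r = r' + 1 := ⟨r - 1, by omega⟩
      simp only [Finset.sum_const, Finset.card_univ, Fintype.card_prod, Fintype.card_fin,
        smul_eq_mul, Nat.add_sub_cancel]
      have hp : 0 < Q.card ^ r' := Nat.pow_pos (by omega)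
      calc _ = ((r' + 1) ^ 3 * (K + 2)) * Q.card ^ r' := by ring
        _ < Q.card * Q.card ^ r' := Nat.mul_lt_mul_of_pos_right hQ hp
        _ = _ := by ring
  obtain ⟨g, hg, hgb⟩ := Finset.exists_mem_notMem_of_card_lt_card hlt
  have hgood : ∀ i j k, k ≠ i → k ≠ j → g k ∉ H (g i) (g j) := by
    intro i j k h1 h2 h3
    exact hgb (Finset.mem_biUnion.mpr ⟨(i, j, k), Finset.mem_univ _,
      Finset.mem_filter.mpr ⟨hg, h1, h2, h3⟩⟩)
  have hinj : Function.Injective g := by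
    intro i k hik
    by_contra hne
    exact hgood i i k (Ne.symm hne) (Ne.symm hne) (by simp [H, hik])
  refine ⟨Finset.univ.image g, ?_, ?_, ?_⟩
  · intro x hx
    obtain ⟨i, _, rfl⟩ := Finset.mem_image.mp hx
    exact Fintype.mem_piFinset.mp hg i
  · rw [Finset.card_image_of_injective _ hinj]; simp
  · intro τ hτ ρ hρ x hx h1 h2 h3
    obtain ⟨i, _, rfl⟩ := Finset.mem_image.mp hτ
    obtain ⟨j, _, rfl⟩ := Finset.mem_image.mp hρ
    obtain ⟨k, _, rfl⟩ := Finset.mem_image.mp hx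
    exact hgood i j k (fun e => h1 (by rw [e])) (fun e => h2 (by rw [e]))
      (Finset.mem_union_left _ h3)

lemma ramsey_seq (k m : ℕ) : ∃ n : ℕ, ∀ (α : Type) [DecidableEq α] (R M : Finset α)
    (P : α → α → α → Prop), M.card ≤ k → n ≤ R.card →
    (∀ τ ∈ R, ∀ ρ ∈ R, τ ≠ ρ → ∃ σ ∈ M, P σ τ ρ) →
    ∃ (L : Finset α) (f : α → α), L ⊆ R ∧ L.card = m ∧ (∀ x ∈ L, 1 < m → f x ∈ M) ∧
      ∃ l : List α, l.Nodup ∧ l.toFinset = L ∧ l.Pairwise (fun x y => P (f x) x y) := by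
  classical
  induction m with
  | zero =>
    refine ⟨0, fun α _ R M P _ _ _ => ⟨∅, id, by simp, by simp, by simp, [], by simp⟩⟩
  | succ m ih =>
    obtain ⟨n, hn⟩ := ih
    refine ⟨(k + 1) * (n + 1) + 2, fun α _ R M P hM hR hP => ?_⟩
    obtain ⟨x, hx⟩ : R.Nonempty := Finset.card_pos.mp (by omega)
    have hc : ∀ y ∈ R.erase x, ∃ σ ∈ M, P σ x y := fun y hy =>
      hP x hx y (Finset.mem_of_mem_erase hy) (Finset.ne_of_mem_erase hy).symm
    have hc' : ∀ y, ∃ σ, y ∈ R.erase x → σ ∈ M ∧ P σ x y := by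
      intro y
      by_cases hy : y ∈ R.erase x
      · obtain ⟨σ, h⟩ := hc y hy; exact ⟨σ, fun _ => h⟩
      · exact ⟨x, fun h => absurd h hy⟩
    choose c hc using hc'
    have hcard : M.card * n < (R.erase x).card := by
      rw [Finset.card_erase_of_mem hx]
      have : M.card * n ≤ (k + 1) * (n + 1) := Nat.mul_le_mul (by omega) (by omega)
      omega
    obtain ⟨σ, hσ, hσn⟩ := Finset.exists_lt_card_fiber_of_mul_lt_card_of_maps_to
      (f := c) (fun y hy => (hc y hy).1) hcard
    obtain ⟨L, f, hL, hLc, hf, l, hl1, hl2, hl3⟩ := hn α ((R.erase x).filter (fun y => c y = σ)) M P hM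
      hσn.le (fun τ hτ ρ hρ hne => hP τ (Finset.mem_of_mem_erase (Finset.mem_filter.mp hτ).1) ρ
        (Finset.mem_of_mem_erase (Finset.mem_filter.mp hρ).1) hne)
    have hxL : x ∉ L := fun h => by simpa using hL h
    have hfx : ∀ y ∈ L, y ≠ x := fun y hy e => hxL (e ▸ hy)
    refine ⟨insert x L, fun y => if y = x then σ else if m = 1 then σ else f y, ?_, ?_, ?_,
      x :: l, ?_, ?_, ?_⟩
    · intro y hy
      rcases Finset.mem_insert.mp hy with rfl | hy
      · exact hx
      · exact Finset.mem_of_mem_erase (Finset.mem_filter.mp (hL hy)).1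
    · rw [Finset.card_insert_of_notMem hxL, hLc]
    · intro y hy hm
      dsimp only
      split_ifs with h1 h2
      · exact hσ
      · exact hσ
      · exact hf y (by simpa [h1] using hy) (by omega)
    · rw [List.nodup_cons]
      exact ⟨fun h => hxL (by rw [← hl2]; simpa using h), hl1⟩
    · simp [hl2]
    · rw [List.pairwise_cons]
      constructor
      · intro y hy
        have hy' : y ∈ L := by rw [← hl2]; simpa using hy
        have := Finset.mem_filter.mp (hL hy')
        have h2 := (hc y this.1).2
        rw [this.2] at h2
        simpa using h2
      · by_cases hm : m = 1
        · have hlen : l.length = 1 := by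
            rw [← List.toFinset_card_of_nodup hl1, hl2, hLc, hm]
          obtain ⟨z, rfl⟩ := List.length_eq_one_iff.mp hlen
          simp
        · refine hl3.imp_of_mem ?_
          intro a b ha hb hab
          have ha' : a ∈ L := by rw [← hl2]; simpa using ha
          simpa [hfx a ha', hm] using hab

lemma ramsey (k m : ℕ) : ∃ n : ℕ, ∀ (α : Type) [DecidableEq α] (R M : Finset α)
    (P : α → α → α → Prop), M.card ≤ k → n ≤ R.card → (∀ σ τ ρ, P σ τ ρ → P σ ρ τ) →
    (∀ τ ∈ R, ∀ ρ ∈ R, τ ≠ ρ → ∃ σ ∈ M, P σ τ ρ) →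
    ∃ J ⊆ R, J.card = m ∧ ∃ σ ∈ M, ∀ τ ∈ J, ∀ ρ ∈ J, τ ≠ ρ → P σ τ ρ := by
  obtain ⟨n, hn⟩ := ramsey_seq k ((k + 1) * (m + 1) + 2)
  refine ⟨n, fun α _ R M P hM hR hs hP => ?_⟩
  obtain ⟨L, f, hL, hLc, hf, l, hl1, hl2, hl3⟩ := hn α R M P hM hR hP
  have hcard : M.card * m < L.card := by
    have : M.card * m ≤ (k + 1) * (m + 1) := Nat.mul_le_mul (by omega) (by omega)
    omega
  obtain ⟨σ, hσ, hσn⟩ := Finset.exists_lt_card_fiber_of_mul_lt_card_of_maps_to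
      (f := f) (fun y hy => hf y hy (by omega)) hcard
  obtain ⟨J, hJ, hJm⟩ := Finset.exists_subset_card_eq hσn.le
  refine ⟨J, fun x hx => hL (Finset.mem_filter.mp (hJ hx)).1, hJm, σ, hσ, ?_⟩
  have key : ∀ τ ∈ l, ∀ ρ ∈ l, τ ≠ ρ → P (f τ) τ ρ ∨ P (f ρ) ρ τ := by
    intro τ hτ ρ hρ hne
    have h1 : l.Pairwise (fun x y => P (f x) x y ∨ P (f y) y x) := hl3.imp (fun h => Or.inl h)
    have : Std.Symm (fun x y => P (f x) x y ∨ P (f y) y x) := ⟨fun _ _ h => h.symm⟩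
    exact h1.forall hτ hρ hne
  intro τ hτ ρ hρ hne
  have h1 := Finset.mem_filter.mp (hJ hτ)
  have h2 := Finset.mem_filter.mp (hJ hρ)
  have m1 : τ ∈ l := by rw [← List.mem_toFinset, hl2]; exact h1.1
  have m2 : ρ ∈ l := by rw [← List.mem_toFinset, hl2]; exact h2.1
  rcases key τ m1 ρ m2 hne with h | h
  · rwa [h1.2] at h
  · rw [h2.2] at h; exact hs _ _ _ h

lemma core_count {s N : ℕ} (hs : 2 ≤ s) {C : Fin N → Equiv.Perm (Fin (s + 3))}
    (hC : IsSuitableCore N (s + 3) (2 * s + 1) C) (σ : Fin (s + 3)) (J : Finset (Fin (s + 3)))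
    (hσ : σ ∉ J) :
    s + J.card ≤ (Finset.univ.filter (fun i : Fin N =>
      ∀ p : Fin (s + 3), p < (C i).symm σ → C i p ∈ J)).card + 1 := by
  classical
  have hcard : ((insert σ J)ᶜ).card = s + 2 - J.card := by
    rw [Finset.card_compl, Finset.card_insert_of_notMem hσ]; simp
  have hJ : J.card ≤ s + 2 := by
    have := Finset.card_le_univ (insert σ J)
    rw [Finset.card_insert_of_notMem hσ] at this
    simp at this; omega
  have h := hC (s + 2 - J.card) (by omega) σ ((insert σ J)ᶜ) (by simp) hcard
  have h2 : (Finset.univ.filter (fun i : Fin N => ∀ τ ∈ (insert σ J)ᶜ,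
      ((C i).symm σ : ℕ) < ((C i).symm τ : ℕ))).card ≤ (Finset.univ.filter (fun i : Fin N =>
      ∀ p : Fin (s + 3), p < (C i).symm σ → C i p ∈ J)).card := by
    apply Finset.card_le_card
    intro i hi
    simp only [Finset.mem_filter, Finset.mem_univ, true_and] at hi ⊢
    intro p hp
    by_contra hn
    have hne : C i p ≠ σ := by
      rintro rfl
      simp at hp
    have := hi (C i p) (by simp [hn, hne])
    simp only [Equiv.symm_apply_apply] at this
    exact absurd hp (not_lt.mpr (le_of_lt (Fin.lt_def.mpr this)))
  omega

lemma core_bound (ℓ n s : ℕ)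
    (hn : ∀ (α : Type) [DecidableEq α] (R M : Finset α)
      (P : α → α → α → Prop), M.card ≤ ℓ + 4 → n ≤ R.card → (∀ σ τ ρ, P σ τ ρ → P σ ρ τ) →
      (∀ τ ∈ R, ∀ ρ ∈ R, τ ≠ ρ → ∃ σ ∈ M, P σ τ ρ) →
      ∃ J ⊆ R, J.card = ℓ + 5 ∧ ∃ σ ∈ M, ∀ τ ∈ J, ∀ ρ ∈ J, τ ≠ ρ → P σ τ ρ)
    (hs : 2 ^ (ℓ + 4) * (n ^ 3 * (ℓ + 3 + 2)) + ℓ + 10 ≤ s)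
    (C : Fin ((s + 1) ^ 2 + ℓ) → Equiv.Perm (Fin (s + 3)))
    (hC : IsSuitableCore ((s + 1) ^ 2 + ℓ) (s + 3) (2 * s + 1) C) : False := by
  classical
  let z0 : Fin (s + 3) := ⟨0, by omega⟩
  let z1 : Fin (s + 3) := ⟨1, by omega⟩
  let z2 : Fin (s + 3) := ⟨2, by omega⟩
  let F : Fin (s + 3) → ℕ := fun σ => (Finset.univ.filter (fun i => C i z0 = σ)).card
  let B : Fin (s + 3) → Fin (s + 3) → Finset (Fin ((s + 1) ^ 2 + ℓ)) := fun τ σ =>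
    Finset.univ.filter (fun i => C i z0 = τ ∧ C i z1 = σ)
  let A : Fin (s + 3) → Fin (s + 3) → ℕ := fun τ σ => (B τ σ).card
  have hF1 : ∀ σ, s ≤ F σ + 1 := by
    intro σ
    have h := core_count (by omega) hC σ ∅ (by simp)
    have h2 : (Finset.univ.filter (fun i =>
      ∀ p : Fin (s + 3), p < (C i).symm σ → C i p ∈ (∅ : Finset (Fin (s + 3))))).card ≤ F σ := by
      apply Finset.card_le_card
      intro i hi
      simp only [Finset.mem_filter, Finset.mem_univ, true_and] at hi ⊢
      by_contra hne
      refine absurd (hi z0 ?_) (by simp)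
      rw [Fin.lt_def]
      apply Nat.pos_of_ne_zero
      intro h0
      apply hne
      rw [← Equiv.eq_symm_apply]
      exact Fin.ext h0.symm
    simp only [Finset.card_empty] at h
    omega
  have hF2 : ∀ σ τ, σ ≠ τ → s + 1 ≤ F σ + A τ σ + 1 := by
    intro σ τ hne
    have h := core_count (by omega) hC σ {τ} (by simpa using hne)
    have h2 : (Finset.univ.filter (fun i =>
      ∀ p : Fin (s + 3), p < (C i).symm σ → C i p ∈ ({τ} : Finset (Fin (s + 3))))).card
        ≤ F σ + A τ σ := by
      refine le_trans (Finset.card_le_card ?_) (Finset.card_union_le _ _)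
      intro i hi
      simp only [B, Finset.mem_filter, Finset.mem_univ, true_and, Finset.mem_union,
        Finset.mem_singleton] at hi ⊢
      by_cases h0 : C i z0 = σ
      · exact Or.inl h0
      right
      have hz0 : z0 < (C i).symm σ := by
        rw [Fin.lt_def]
        apply Nat.pos_of_ne_zero
        intro h0'
        apply h0
        rw [← Equiv.eq_symm_apply]
        exact Fin.ext h0'.symm
      refine ⟨hi z0 hz0, ?_⟩
      rw [← Equiv.eq_symm_apply]
      by_contra h1
      have hz1 : z1 < (C i).symm σ := by
        rw [Fin.lt_def] at hz0 ⊢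
        have : ((C i).symm σ : ℕ) ≠ 1 := fun e => h1 (Fin.ext e.symm)
        simp only [z0, z1] at *
        omega
      have := (C i).injective ((hi z0 hz0).trans (hi z1 hz1).symm)
      simp [z0, z1] at this
    simp only [Finset.card_singleton] at h
    omega
  have hFsum : ∑ σ, F σ = (s + 1) ^ 2 + ℓ := by
    have := Finset.card_eq_sum_card_fiberwise (s := (Finset.univ : Finset (Fin ((s + 1) ^ 2 + ℓ))))
      (t := (Finset.univ : Finset (Fin (s + 3)))) (f := fun i => C i z0) (by intro x _; simp)
    simpa [F] using this.symm
  have hAsum : ∀ τ, ∑ σ, A τ σ = F τ := by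
    intro τ
    have := Finset.card_eq_sum_card_fiberwise
      (s := (Finset.univ.filter (fun i => C i z0 = τ)))
      (t := (Finset.univ : Finset (Fin (s + 3)))) (f := fun i => C i z1) (by intro x _; simp)
    simp only [Finset.filter_filter] at this
    exact this.symm
  -- excess
  have hE : ∑ σ, (F σ + 1 - s) = ℓ + 4 := by
    have h1 : ∑ σ, ((F σ + 1 - s) + s) = ∑ σ, (F σ + 1) :=
      Finset.sum_congr rfl (fun σ _ => Nat.sub_add_cancel (hF1 σ))
    rw [Finset.sum_add_distrib, Finset.sum_add_distrib, hFsum] at h1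
    simp at h1
    nlinarith
  have hFle : ∀ σ, F σ + 1 ≤ s + ℓ + 4 := by
    intro σ
    have := Finset.single_le_sum (f := fun σ => F σ + 1 - s) (fun _ _ => Nat.zero_le _)
      (Finset.mem_univ σ)
    simp only [hE] at this
    omega
  let W : Finset (Fin (s + 3)) := Finset.univ.filter (fun σ => s ≤ F σ)
  have hW : W.card ≤ ℓ + 4 := by
    rw [← hE, Finset.card_eq_sum_ones]
    refine le_trans (Finset.sum_le_sum (fun σ hσ => ?_))
      (Finset.sum_le_sum_of_subset (Finset.subset_univ W))
    have := (Finset.mem_filter.mp hσ).2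
    omega
  have hFZ : ∀ τ, τ ∉ W → F τ + 1 = s := by
    intro τ hτ
    have h1 : ¬ s ≤ F τ := fun h => hτ (Finset.mem_filter.mpr ⟨Finset.mem_univ _, h⟩)
    have := hF1 τ
    omega
  have hA1 : ∀ τ σ, σ ∉ W → σ ≠ τ → 1 ≤ A τ σ := by
    intro τ σ hσ hne
    have := hF2 σ τ hne
    have := hFZ σ hσ
    omega
  have hAself : ∀ τ, A τ τ = 0 := by
    intro τ
    refine Finset.card_eq_zero.mpr (Finset.filter_eq_empty_iff.mpr ?_)
    rintro i _ ⟨h1, h2⟩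
    have := (C i).injective (h1.trans h2.symm)
    simp [z0, z1] at this
  let Mf : Fin (s + 3) → Finset (Fin (s + 3)) := fun τ => W.filter (fun σ => A τ σ = 0)
  have hM3 : ∀ τ, τ ∉ W → 3 ≤ (Mf τ).card := by
    intro τ hτ
    have hsupp : (Finset.univ.filter (fun σ => ¬ A τ σ = 0)).card ≤ F τ := by
      rw [← hAsum τ, Finset.card_eq_sum_ones]
      refine le_trans (Finset.sum_le_sum (fun σ hσ => ?_))
        (Finset.sum_le_sum_of_subset (Finset.subset_univ _))
      exact Nat.pos_of_ne_zero (Finset.mem_filter.mp hσ).2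
    have hsplit := Finset.card_filter_add_card_filter_not
      (s := (Finset.univ : Finset (Fin (s + 3)))) (fun σ => A τ σ = 0)
    have hsub : Finset.univ.filter (fun σ => A τ σ = 0) ⊆ insert τ (Mf τ) := by
      intro σ hσ
      have h0 := (Finset.mem_filter.mp hσ).2
      by_cases he : σ = τ
      · simp [he]
      · refine Finset.mem_insert_of_mem (Finset.mem_filter.mpr ⟨?_, h0⟩)
        by_contra hw
        have := hA1 τ σ hw he
        omega
    have h4 := (Finset.card_le_card hsub).trans (Finset.card_insert_le _ _)
    have := hFZ τ hτ
    simp at hsplit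
    omega
  have hD : ∀ τ, τ ∉ W → (Finset.univ.filter (fun σ => 2 ≤ A τ σ)).card ≤ ℓ + 3 := by
    intro τ hτ
    have h1 : (Wᶜ.erase τ).card + (Finset.univ.filter (fun σ => 2 ≤ A τ σ)).card ≤ F τ := by
      rw [← hAsum τ, Finset.card_filter, ← Finset.sum_filter_add_sum_filter_not
        Finset.univ (fun σ => σ ∈ Wᶜ.erase τ) (fun σ => A τ σ)]
      rw [← Finset.sum_filter_add_sum_filter_not
        Finset.univ (fun σ => σ ∈ Wᶜ.erase τ) (fun σ => if 2 ≤ A τ σ then 1 else 0)]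
      rw [← add_assoc]
      apply Nat.add_le_add
      · have : (Wᶜ.erase τ).card = ∑ σ ∈ Finset.univ.filter (fun σ => σ ∈ Wᶜ.erase τ), 1 := by
          rw [← Finset.card_eq_sum_ones]; congr 1; ext; simp
        rw [this, ← Finset.sum_add_distrib]
        apply Finset.sum_le_sum
        intro σ hσ
        have hσ := (Finset.mem_filter.mp hσ).2
        have := hA1 τ σ (by simpa using Finset.mem_of_mem_erase hσ) (Finset.ne_of_mem_erase hσ)
        split_ifs <;> omega
      · apply Finset.sum_le_sum
        intro σ hσ
        split_ifs <;> omega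
    rw [Finset.card_erase_of_mem (by simpa using hτ), Finset.card_compl] at h1
    have := hFZ τ hτ
    simp at h1
    omega
  -- pigeonhole on types
  obtain ⟨M, hMW, hMn⟩ : ∃ M ∈ W.powerset, n ^ 3 * (ℓ + 3 + 2) <
      (Wᶜ.filter (fun τ => Mf τ = M)).card := by
    apply Finset.exists_lt_card_fiber_of_mul_lt_card_of_maps_to
    · intro τ _
      exact Finset.mem_powerset.mpr (Finset.filter_subset _ _)
    · rw [Finset.card_powerset, Finset.card_compl]
      have h1 : 2 ^ W.card ≤ 2 ^ (ℓ + 4) := Nat.pow_le_pow_right (by norm_num) hW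
      have h2 := Nat.mul_le_mul_right (n ^ 3 * (ℓ + 3 + 2)) h1
      simp only [Fintype.card_fin]
      omega
  let h : Fin (s + 3) → Fin (s + 3) → Finset (Fin (s + 3)) := fun τ ρ =>
    if τ = ρ then (if τ ∈ W then ∅ else Finset.univ.filter (fun σ => 2 ≤ A τ σ))
    else (if A τ ρ ≤ 1 then (B τ ρ).image (fun i => C i z2) else ∅)
  have hh : ∀ τ ρ, (h τ ρ).card ≤ ℓ + 3 := by
    intro τ ρ
    dsimp only [h]
    split_ifs with h1 h2 h3
    · simp
    · exact hD τ h2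
    · refine Finset.card_image_le.trans (le_trans h3 (by omega))
    · simp
  obtain ⟨R, hRQ, hRc, hfree⟩ := exists_free n (ℓ + 3) _ h hh hMn
  have hRW : ∀ τ ∈ R, τ ∉ W := fun τ hτ => by
    simpa using (Finset.mem_filter.mp (hRQ hτ)).1
  have hRM : ∀ τ ∈ R, Mf τ = M := fun τ hτ => (Finset.mem_filter.mp (hRQ hτ)).2
  have hR1 : ∀ τ ∈ R, ∀ ρ ∈ R, τ ≠ ρ → A τ ρ ≤ 1 := by
    intro τ hτ ρ hρ hne
    have := hfree τ hτ τ hτ ρ hρ hne.symm hne.symm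
    simp [h, hRW τ hτ] at this
    omega
  have hR3 : ∀ i, C i z0 ∈ R → C i z1 ∈ R → C i z2 ∉ R := by
    intro i h0 h1 h2
    have n01 : C i z0 ≠ C i z1 := (C i).injective.ne (by simp [z0, z1])
    have n20 : C i z2 ≠ C i z0 := (C i).injective.ne (by simp [z0, z2])
    have n21 : C i z2 ≠ C i z1 := (C i).injective.ne (by simp [z1, z2])
    apply hfree _ h0 _ h1 _ h2 n20 n21
    simp only [h, if_neg n01, if_pos (hR1 _ h0 _ h1 n01)]
    exact Finset.mem_image.mpr ⟨i, by simp [B], rfl⟩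
  have hMc : M.card ≤ ℓ + 4 :=
    (Finset.card_le_card (Finset.mem_powerset.mp hMW)).trans hW
  obtain ⟨J, hJR, hJc, σ, hσM, hσ⟩ := hn (Fin (s + 3)) R M
    (fun σ τ ρ => ∀ i ∈ B τ ρ ∪ B ρ τ, C i z2 ≠ σ) hMc hRc.ge
    (fun σ τ ρ hp i hi => hp i (by rwa [Finset.union_comm])) (by
      intro τ hτ ρ hρ hne
      by_contra hcon
      push Not at hcon
      have hsub : M ⊆ (B τ ρ ∪ B ρ τ).image (fun i => C i z2) := by
        intro σ hσ
        obtain ⟨i, hi, he⟩ := hcon σ hσ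
        exact Finset.mem_image.mpr ⟨i, hi, he⟩
      have h1 := ((Finset.card_le_card hsub).trans Finset.card_image_le).trans
        (Finset.card_union_le _ _)
      have h2 := hR1 τ hτ ρ hρ hne
      have h3 := hR1 ρ hρ τ hτ hne.symm
      have h4 := hM3 τ (hRW τ hτ)
      rw [hRM τ hτ] at h4
      simp only [A] at h2 h3
      omega)
  have hσW : σ ∈ W := Finset.mem_powerset.mp hMW hσM
  have hσJ : σ ∉ J := fun hj => hRW σ (hJR hj) hσW
  have hfin := core_count (by omega) hC σ J hσJ
  have hle : (Finset.univ.filter (fun i =>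
      ∀ p : Fin (s + 3), p < (C i).symm σ → C i p ∈ J)).card ≤ F σ := by
    apply Finset.card_le_card
    intro i hi
    simp only [Finset.mem_filter, Finset.mem_univ, true_and] at hi ⊢
    by_contra h0
    have hp0 : ((C i).symm σ : ℕ) ≠ 0 := fun e => h0 (by
      rw [← Equiv.eq_symm_apply]; exact Fin.ext e.symm)
    have hJ0 : C i z0 ∈ J := hi z0 (by rw [Fin.lt_def]; simp only [z0]; omega)
    have hp1 : ((C i).symm σ : ℕ) ≠ 1 := fun e => by
      have e1 : C i z1 = σ := by rw [← Equiv.eq_symm_apply]; exact Fin.ext e.symm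
      have hm := hσM
      rw [← hRM _ (hJR hJ0)] at hm
      have hA0 := (Finset.mem_filter.mp hm).2
      have : i ∈ B (C i z0) σ := by simp [B, e1]
      rw [Finset.card_eq_zero.mp hA0] at this
      simp at this
    have hJ1 : C i z1 ∈ J := hi z1 (by rw [Fin.lt_def]; simp only [z1]; omega)
    have n01 : C i z0 ≠ C i z1 := (C i).injective.ne (by simp [z0, z1])
    have hp2 : ((C i).symm σ : ℕ) ≠ 2 := fun e => by
      have e1 : C i z2 = σ := by rw [← Equiv.eq_symm_apply]; exact Fin.ext e.symm
      exact hσ _ hJ0 _ hJ1 n01 i (by simp [B]) e1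
    have hJ2 : C i z2 ∈ J := hi z2 (by rw [Fin.lt_def]; simp only [z2]; omega)
    exact hR3 i (hJR hJ0) (hJR hJ1) (hJR hJ2)
  have := hFle σ
  omega

/-- For each fixed `ℓ ≥ 0` there exists `s₀` such that for all `s ≥ s₀` there
is no `((s+1)² + ℓ, s+3, 2s+1)`-suitable core. -/
theorem eventually_not_exists_suitableCore_odd_plus_ell
    (ℓ : ℕ) :
    ∃ s₀ : ℕ, ∀ s : ℕ, s₀ ≤ s →
      ¬ ∃ C : Fin ((s + 1) ^ 2 + ℓ) → Equiv.Perm (Fin (s + 3)),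
        IsSuitableCore ((s + 1) ^ 2 + ℓ) (s + 3) (2 * s + 1) C := by
  obtain ⟨n, hn⟩ := ramsey (ℓ + 4) (ℓ + 5)
  refine ⟨2 ^ (ℓ + 4) * (n ^ 3 * (ℓ + 3 + 2)) + ℓ + 10, fun s hs => ?_⟩
  rintro ⟨C, hC⟩
  exact core_bound ℓ n s hn hs C hC
end

section
/- For each fixed nonnegative integer ℓ, there exists an integer s₀ (depending on ℓ) such that for all integers s ≥ s₀ there does not exist an (s(s+1)+ℓ, s+3, 2s)-suitable core. (Combined with Colbourn's construction, this shows SCN(2s, s(s+1)+ℓ) = s+2 for all s ≥ s₀.) -/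
/-- Two-colour Ramsey theorem, in the form needed here. -/
theorem ramsey_aux (n : ℕ) : ∀ a b : ℕ, a + b = n → ∃ M : ℕ, ∀ {V : Type} [DecidableEq V]
    (R : V → V → Prop), (∀ x y, R x y → R y x) → ∀ S : Finset V, M ≤ S.card →
      (∃ T ⊆ S, T.card = a ∧ ∀ x ∈ T, ∀ y ∈ T, x ≠ y → R x y) ∨
      (∃ T ⊆ S, T.card = b ∧ ∀ x ∈ T, ∀ y ∈ T, x ≠ y → ¬ R x y) := by
  induction n with
  | zero =>
    intro a b hab
    refine ⟨0, fun R _ S _ => Or.inl ⟨∅, by simp, ?_, by simp⟩⟩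
    simp; omega
  | succ n ih =>
    intro a b hab
    rcases a with _ | a
    · exact ⟨0, fun R _ S _ => Or.inl ⟨∅, by simp, by simp, by simp⟩⟩
    rcases b with _ | b
    · exact ⟨0, fun R _ S _ => Or.inr ⟨∅, by simp, by simp, by simp⟩⟩
    obtain ⟨M1, h1⟩ := ih a (b + 1) (by omega)
    obtain ⟨M2, h2⟩ := ih (a + 1) b (by omega)
    refine ⟨M1 + M2 + 1, fun {V} _ R hR S hS => ?_⟩
    classical
    obtain ⟨x, hx⟩ : S.Nonempty := Finset.card_pos.mp (by omega)
    have hsplit := Finset.card_filter_add_card_filter_not (s := S.erase x) (fun y => R x y)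
    rw [Finset.card_erase_of_mem hx] at hsplit
    by_cases hc : M1 ≤ ((S.erase x).filter (fun y => R x y)).card
    · rcases h1 R hR _ hc with ⟨T, hT, hTc, hTR⟩ | ⟨T, hT, hTc, hTR⟩
      · left
        have hxT : x ∉ T := fun h => by simpa using hT h
        refine ⟨insert x T, ?_, by rw [Finset.card_insert_of_notMem hxT, hTc], ?_⟩
        · intro y hy
          rcases Finset.mem_insert.mp hy with rfl | hy
          · exact hx
          · exact Finset.mem_of_mem_erase (Finset.mem_filter.mp (hT hy)).1
        · intro y hy z hz hyz
          rcases Finset.mem_insert.mp hy with rfl | hy'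
          · rcases Finset.mem_insert.mp hz with rfl | hz
            · exact absurd rfl hyz
            · exact (Finset.mem_filter.mp (hT hz)).2
          · rcases Finset.mem_insert.mp hz with rfl | hz
            · exact hR _ _ (Finset.mem_filter.mp (hT hy')).2
            · exact hTR y hy' z hz hyz
      · right
        exact ⟨T, fun y hy => Finset.mem_of_mem_erase (Finset.mem_filter.mp (hT hy)).1, hTc, hTR⟩
    · have hc2 : M2 ≤ ((S.erase x).filter (fun y => ¬ R x y)).card := by omega
      rcases h2 R hR _ hc2 with ⟨T, hT, hTc, hTR⟩ | ⟨T, hT, hTc, hTR⟩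
      · left
        exact ⟨T, fun y hy => Finset.mem_of_mem_erase (Finset.mem_filter.mp (hT hy)).1, hTc, hTR⟩
      · right
        have hxT : x ∉ T := fun h => by simpa using hT h
        refine ⟨insert x T, ?_, by rw [Finset.card_insert_of_notMem hxT, hTc], ?_⟩
        · intro y hy
          rcases Finset.mem_insert.mp hy with rfl | hy
          · exact hx
          · exact Finset.mem_of_mem_erase (Finset.mem_filter.mp (hT hy)).1
        · intro y hy z hz hyz
          rcases Finset.mem_insert.mp hy with rfl | hy'
          · rcases Finset.mem_insert.mp hz with rfl | hz
            · exact absurd rfl hyz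
            · exact (Finset.mem_filter.mp (hT hz)).2
          · rcases Finset.mem_insert.mp hz with rfl | hz
            · exact fun h => (Finset.mem_filter.mp (hT hy')).2 (hR _ _ h)
            · exact hTR y hy' z hz hyz

/-- Iterated form: if no `m`-subset is independent, there is a large clique. -/
theorem ramsey_clique (m k : ℕ) : ∃ M : ℕ, ∀ {V : Type} [DecidableEq V]
    (R : V → V → Prop), (∀ x y, R x y → R y x) → ∀ S : Finset V, M ≤ S.card →
      (∀ T ⊆ S, T.card = m → ∃ x ∈ T, ∃ y ∈ T, x ≠ y ∧ R x y) →
      ∃ T ⊆ S, T.card = k ∧ ∀ x ∈ T, ∀ y ∈ T, x ≠ y → R x y := by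
  obtain ⟨M, hM⟩ := ramsey_aux (k + m) k m rfl
  refine ⟨M, fun {V} _ R hR S hS h => ?_⟩
  rcases hM R hR S hS with h1 | ⟨T, hT, hTc, hTR⟩
  · exact h1
  · obtain ⟨x, hx, y, hy, hxy, hr⟩ := h T hT hTc
    exact absurd hr (hTR x hx y hy hxy)

/-- The symbols preceding `x` in a row. -/
def predSet {v : ℕ} (p : Equiv.Perm (Fin v)) (x : Fin v) : Finset (Fin v) :=
  Finset.univ.filter (fun y => p.symm y < p.symm x)

theorem card_predSet {v : ℕ} (p : Equiv.Perm (Fin v)) (x : Fin v) :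
    (predSet p x).card = (p.symm x : ℕ) := by
  have h : predSet p x = (Finset.Iio (p.symm x)).map p.toEmbedding := by
    ext y
    simp only [predSet, Finset.mem_filter, Finset.mem_univ, true_and, Finset.mem_map_equiv,
      Finset.mem_Iio]
  rw [h, Finset.card_map, Fin.card_Iio]

theorem core_pred {r N : ℕ} (hr : 1 ≤ r) (C : Fin N → Equiv.Perm (Fin (r + 5)))
    (hC : IsSuitableCore N (r + 5) (2 * (r + 2)) C) (x : Fin (r + 5)) (T : Finset (Fin (r + 5)))
    (hx : x ∉ T) : r + T.card ≤ (Finset.univ.filter (fun i => predSet (C i) x ⊆ T)).card := by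
  have hc : (insert x T)ᶜ.card = r + 5 - (T.card + 1) := by
    rw [Finset.card_compl, Finset.card_insert_of_notMem hx, Fintype.card_fin]
  have hle : (insert x T).card ≤ r + 5 := by
    simpa using Finset.card_le_univ (insert x T)
  rw [Finset.card_insert_of_notMem hx] at hle
  have h := hC _ (by omega) x (insert x T)ᶜ (by simp) hc
  refine le_trans (by omega) (le_trans h (Finset.card_le_card ?_))
  intro i hi
  simp only [Finset.mem_filter, Finset.mem_univ, true_and] at hi ⊢
  intro y hy
  by_contra hyT
  simp only [predSet, Finset.mem_filter, Finset.mem_univ, true_and] at hy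
  have hyx : y ≠ x := by rintro rfl; exact lt_irrefl _ hy
  have := hi y (by simp [hyx, hyT])
  exact absurd hy (not_lt.mpr (Fin.le_def.mpr this.le))

theorem pred_facts {r : ℕ} (p : Equiv.Perm (Fin (r + 5))) (x : Fin (r + 5)) :
    (predSet p x = ∅ ↔ p 0 = x) ∧ ((predSet p x).Nonempty → p 0 ∈ predSet p x) ∧
    ((predSet p x).Nonempty → p 1 = x ∨ p 1 ∈ predSet p x) ∧
    (∀ y, predSet p x = {y} → p 0 = y ∧ p 1 = x) := by
  have key : ∀ y, y ∈ predSet p x ↔ p.symm y < p.symm x := by simp [predSet]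
  have hne : (predSet p x).Nonempty → 0 < (p.symm x : ℕ) := by
    intro h; rw [← card_predSet]; exact Finset.card_pos.mpr h
  have h1 : (predSet p x = ∅ ↔ p 0 = x) := by
    rw [← Finset.card_eq_zero, card_predSet, ← Equiv.eq_symm_apply, eq_comm (a := (0 : Fin (r+5))),
      Fin.ext_iff]; rfl
  have h2 : (predSet p x).Nonempty → p 0 ∈ predSet p x := by
    intro h
    rw [key, Equiv.symm_apply_apply, Fin.lt_def]
    exact hne h
  refine ⟨h1, h2, ?_, ?_⟩
  · intro h
    have := hne h
    rw [key, Equiv.symm_apply_apply, Fin.lt_def, ← Equiv.eq_symm_apply, Fin.ext_iff]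
    have e1 : ((1 : Fin (r + 5)) : ℕ) = 1 := rfl
    rw [e1]; omega
  · intro y hy
    have hn : (predSet p x).Nonempty := by rw [hy]; simp
    have := h2 hn
    rw [hy, Finset.mem_singleton] at this
    refine ⟨this, ?_⟩
    rw [← Equiv.eq_symm_apply, Fin.ext_iff, ← card_predSet, hy]; rfl

theorem main_aux (ℓ : ℕ) : ∃ r₀ : ℕ, ∀ r : ℕ, r₀ ≤ r → ∀ C : Fin ((r + 2) * (r + 3) + ℓ) →
    Equiv.Perm (Fin (r + 5)),
    ¬ IsSuitableCore ((r + 2) * (r + 3) + ℓ) (r + 5) (2 * (r + 2)) C := by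
  obtain ⟨M3, hM3⟩ := ramsey_clique (ℓ + 7) (2 * ℓ + 6)
  obtain ⟨M2, hM2⟩ := ramsey_clique (ℓ + 7) M3
  obtain ⟨M1, hM1⟩ := ramsey_clique (ℓ + 7) M2
  refine ⟨2 ^ (ℓ + 6) * (M1 + 1) + ℓ + 7, fun r hr C hC => ?_⟩
  classical
  have hpred := core_pred (by omega) C hC
  -- number of rows starting with a given symbol
  set f : Fin (r + 5) → ℕ := fun x => (Finset.univ.filter (fun i => C i 0 = x)).card with hf
  have hfempty : ∀ x, (Finset.univ.filter (fun i => predSet (C i) x ⊆ ∅)).card = f x := by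
    intro x
    simp only [hf]
    congr 1
    ext i
    simp only [Finset.mem_filter, Finset.mem_univ, true_and, Finset.subset_empty]
    exact (pred_facts (C i) x).1
  have hfge : ∀ x, r ≤ f x := by
    intro x
    have := hpred x ∅ (by simp)
    rw [hfempty] at this
    simpa using this
  have hfsum : ∑ x, f x = (r + 2) * (r + 3) + ℓ := by
    have := Finset.card_eq_sum_card_fiberwise (s := (Finset.univ : Finset (Fin ((r + 2) * (r + 3) + ℓ))))
      (t := Finset.univ) (f := fun i => C i 0) (by intro i _; simp)
    simp only [Finset.card_univ, Fintype.card_fin] at this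
    exact this.symm
  have hesum : ∑ x, (f x - r) = ℓ + 6 := by
    have h1 : ∑ x, f x = ∑ x, (f x - r) + ∑ x : Fin (r + 5), r := by
      rw [← Finset.sum_add_distrib]
      exact Finset.sum_congr rfl (fun x _ => by have := hfge x; omega)
    rw [hfsum] at h1
    simp only [Finset.sum_const, Finset.card_univ, Fintype.card_fin, smul_eq_mul] at h1
    nlinarith
  have he : ∀ x, f x ≤ r + (ℓ + 6) := by
    intro x
    have := Finset.single_le_sum (f := fun x => f x - r) (fun _ _ => Nat.zero_le _)
      (Finset.mem_univ x)
    simp only [hesum] at this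
    omega
  set P : Finset (Fin (r + 5)) := Finset.univ.filter (fun x => f x ≠ r) with hP
  set L : Finset (Fin (r + 5)) := Finset.univ.filter (fun x => f x = r) with hL
  have hPcard : P.card ≤ ℓ + 6 := by
    rw [← hesum, Finset.card_eq_sum_ones]
    calc ∑ x ∈ P, 1 ≤ ∑ x ∈ P, (f x - r) := Finset.sum_le_sum (fun x hx => by
            have h1 := hfge x
            have h2 := (Finset.mem_filter.mp hx).2
            omega)
      _ ≤ ∑ x, (f x - r) := Finset.sum_le_sum_of_subset (Finset.subset_univ _)
  have hLP : L.card + P.card = r + 5 := by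
    have := Finset.card_filter_add_card_filter_not (s := (Finset.univ : Finset (Fin (r + 5))))
      (fun x => f x = r)
    simpa using this
  -- key covering property
  have hcov : ∀ x T, x ∉ T → f x < r + T.card →
      ∃ i, (predSet (C i) x).Nonempty ∧ predSet (C i) x ⊆ T := by
    intro x T hx hT
    have h1 := hpred x T hx
    rw [← hfempty x] at hT
    obtain ⟨i, hi, hi2⟩ := Finset.exists_mem_notMem_of_card_lt_card (lt_of_lt_of_le hT h1)
    simp only [Finset.mem_filter, Finset.mem_univ, true_and, Finset.subset_empty] at hi hi2
    exact ⟨i, Finset.nonempty_iff_ne_empty.mpr hi2, hi⟩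
  have hLsec : ∀ x ∈ L, ∀ y, y ≠ x → ∃ i, C i 0 = y ∧ C i 1 = x := by
    intro x hx y hyx
    have hfx := (Finset.mem_filter.mp hx).2
    obtain ⟨i, hi, hi2⟩ := hcov x {y} (by simpa using hyx.symm) (by simp [hfx])
    refine ⟨i, (pred_facts (C i) x).2.2.2 y ?_⟩
    rcases Finset.subset_singleton_iff.mp hi2 with h | h
    · exact absurd h hi.ne_empty
    · exact h
  -- symbols never second after `τ`
  set W : Fin (r + 5) → Finset (Fin (r + 5)) := fun τ =>
    Finset.univ.filter (fun x => x ≠ τ ∧ ∀ i, C i 0 = τ → C i 1 ≠ x) with hW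
  have hWP : ∀ τ, W τ ⊆ P := by
    intro τ x hx
    simp only [hW, Finset.mem_filter, Finset.mem_univ, true_and] at hx
    simp only [hP, Finset.mem_filter, Finset.mem_univ, true_and]
    intro hfx
    obtain ⟨i, h1, h2⟩ := hLsec x (by simp [hL, hfx]) τ hx.1.symm
    exact hx.2 i h1 h2
  have hWcard : ∀ τ ∈ L, 4 ≤ (W τ).card := by
    intro τ hτ
    have hfτ := (Finset.mem_filter.mp hτ).2
    set Sec := (Finset.univ.filter (fun i => C i 0 = τ)).image (fun i => C i 1) with hSec
    have hSc : Sec.card ≤ r := by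
      exact le_trans Finset.card_image_le hfτ.le
    have hsub : (insert τ Sec)ᶜ ⊆ W τ := by
      intro x hx
      simp only [hSec, Finset.mem_compl, Finset.mem_insert, Finset.mem_image, Finset.mem_filter,
        Finset.mem_univ, true_and, not_or, not_exists, not_and] at hx
      simp only [hW, Finset.mem_filter, Finset.mem_univ, true_and]
      exact hx
    have h1 := Finset.card_le_card hsub
    rw [Finset.card_compl, Fintype.card_fin] at h1
    have h2 := Finset.card_insert_le τ Sec
    omega
  -- pigeonhole
  obtain ⟨W0, hW0, hK⟩ : ∃ W0 ∈ P.powerset, M1 + 1 ≤ (L.filter (fun τ => W τ = W0)).card := by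
    apply Finset.exists_le_card_fiber_of_mul_le_card_of_maps_to
    · intro τ _
      exact Finset.mem_powerset.mpr (hWP τ)
    · exact ⟨∅, by simp⟩
    · rw [Finset.card_powerset]
      have : 2 ^ P.card * (M1 + 1) ≤ 2 ^ (ℓ + 6) * (M1 + 1) :=
        Nat.mul_le_mul_right _ (Nat.pow_le_pow_right (by norm_num) hPcard)
      omega
  set K := L.filter (fun τ => W τ = W0) with hKdef
  have hW0P : W0 ⊆ P := Finset.mem_powerset.mp hW0
  have hKL : K ⊆ L := Finset.filter_subset _ _
  have hKW : ∀ τ ∈ K, W τ = W0 := fun τ hτ => (Finset.mem_filter.mp hτ).2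
  have hPK : ∀ x ∈ P, x ∉ K := by
    intro x hx hxK
    exact (Finset.mem_filter.mp hx).2 (Finset.mem_filter.mp (hKL hxK)).2
  -- the colouring
  set R : Fin (r + 5) → Fin (r + 5) → Fin (r + 5) → Prop := fun σ a b =>
    ∃ i, ((C i 0 = a ∧ C i 1 = b) ∨ (C i 0 = b ∧ C i 1 = a)) ∧ predSet (C i) σ ⊆ K with hR
  have hRsymm : ∀ σ a b, R σ a b → R σ b a := by
    rintro σ a b ⟨i, h1, h2⟩
    exact ⟨i, h1.symm, h2⟩
  have hRcov : ∀ σ ∈ W0, ∀ T ⊆ K, T.card = ℓ + 7 → ∃ x ∈ T, ∃ y ∈ T, x ≠ y ∧ R σ x y := by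
    intro σ hσ T hT hTc
    have hσK := hPK σ (hW0P hσ)
    obtain ⟨i, hi, hi2⟩ := hcov σ T (fun h => hσK (hT h)) (by have := he σ; omega)
    have h0 := (pred_facts (C i) σ).2.1 hi
    have h1 : C i 1 ∈ predSet (C i) σ := by
      rcases (pred_facts (C i) σ).2.2.1 hi with h | h
      · exfalso
        have h3 : σ ∈ W (C i 0) := by rw [hKW _ (hT (hi2 h0))]; exact hσ
        exact (Finset.mem_filter.mp h3).2.2 i rfl h
      · exact h
    refine ⟨_, hi2 h0, _, hi2 h1, ?_, i, Or.inl ⟨rfl, rfl⟩, hi2.trans hT⟩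
    intro h
    have := congrArg Fin.val ((C i).injective h)
    have e1 : ((1 : Fin (r + 5)) : ℕ) = 1 := rfl
    rw [e1] at this
    exact absurd this (by simp)
  -- three symbols
  have hW03 : 2 < W0.card := by
    obtain ⟨τ, hτ⟩ : K.Nonempty := Finset.card_pos.mp (by omega)
    have := hWcard τ (hKL hτ)
    rw [hKW τ hτ] at this
    omega
  obtain ⟨σ1, σ2, σ3, hσ1, hσ2, hσ3, h12, h13, h23⟩ := Finset.two_lt_card_iff.mp hW03
  obtain ⟨K1, hK1, hK1c, hK1R⟩ := hM1 (R σ1) (hRsymm σ1) K (by omega) (hRcov σ1 hσ1)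
  obtain ⟨K2, hK2, hK2c, hK2R⟩ := hM2 (R σ2) (hRsymm σ2) K1 (by omega)
    (fun T hT => hRcov σ2 hσ2 T (hT.trans hK1))
  obtain ⟨K3, hK3, hK3c, hK3R⟩ := hM3 (R σ3) (hRsymm σ3) K2 (by omega)
    (fun T hT => hRcov σ3 hσ3 T (hT.trans (hK2.trans hK1)))
  have hK3K : K3 ⊆ K := hK3.trans (hK2.trans hK1)
  set Q := Finset.univ.filter (fun i => C i 0 ∈ K3 ∧ C i 1 ∈ K3) with hQ
  -- upper bound on the number of rows starting inside `K3`
  have hQle : Q.card ≤ K3.card * (K3.card + (ℓ + 1)) := by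
    have hmaps : ∀ i ∈ Q, C i 0 ∈ K3 := fun i hi => (Finset.mem_filter.mp hi).2.1
    rw [Finset.card_eq_sum_card_fiberwise hmaps]
    refine le_trans (Finset.sum_le_card_nsmul _ _ (K3.card + (ℓ + 1)) ?_) (by rw [smul_eq_mul])
    intro τ hτ
    have hτL := hKL (hK3K hτ)
    have hfτ : (Finset.univ.filter (fun i => C i 0 = τ)).card = r := (Finset.mem_filter.mp hτL).2
    have hsplit := Finset.card_filter_add_card_filter_not
      (s := Finset.univ.filter (fun i => C i 0 = τ)) (fun i => C i 1 ∈ K3)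
    have hA : (Q.filter (fun i => C i 0 = τ)).card ≤
        ((Finset.univ.filter (fun i => C i 0 = τ)).filter (fun i => C i 1 ∈ K3)).card := by
      apply Finset.card_le_card
      intro i hi
      simp only [hQ, Finset.mem_filter, Finset.mem_univ, true_and] at hi ⊢
      exact ⟨hi.2, hi.1.2⟩
    have hB : (L \ K3).card ≤
        ((Finset.univ.filter (fun i => C i 0 = τ)).filter (fun i => ¬ C i 1 ∈ K3)).card := by
      refine le_trans (Finset.card_le_card ?_) (Finset.card_image_le (f := fun i => C i 1))
      intro x hx
      obtain ⟨hxL, hxK⟩ := Finset.mem_sdiff.mp hx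
      obtain ⟨i, h0, h1⟩ := hLsec x hxL τ (fun h => hxK (h ▸ hτ))
      refine Finset.mem_image.mpr ⟨i, ?_, h1⟩
      simp only [Finset.mem_filter, Finset.mem_univ, true_and]
      exact ⟨h0, h1 ▸ hxK⟩
    have hC2 := Finset.le_card_sdiff K3 L
    omega
  -- lower bound
  have hlow : ∀ σ, (∀ x ∈ K3, ∀ y ∈ K3, x ≠ y → R σ x y) →
      K3.card * K3.card - K3.card ≤ 2 * (Q.filter (fun i => predSet (C i) σ ⊆ K)).card := by
    intro σ hσ
    rw [← Finset.offDiag_card]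
    set Qσ := Q.filter (fun i => predSet (C i) σ ⊆ K) with hQσ
    have hsub : K3.offDiag ⊆ Qσ.image (fun i => (C i 0, C i 1)) ∪
        Qσ.image (fun i => (C i 1, C i 0)) := by
      rintro ⟨a, b⟩ hab
      obtain ⟨ha, hb, hne⟩ := Finset.mem_offDiag.mp hab
      obtain ⟨i, h1, h2⟩ := hσ a ha b hb hne
      rw [Finset.mem_union]
      rcases h1 with ⟨rfl, rfl⟩ | ⟨rfl, rfl⟩
      · left
        exact Finset.mem_image.mpr ⟨i, by simp [hQσ, hQ, h2]; exact ⟨ha, hb⟩, rfl⟩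
      · right
        exact Finset.mem_image.mpr ⟨i, by simp [hQσ, hQ, h2]; exact ⟨hb, ha⟩, rfl⟩
    have h1 := Finset.card_le_card hsub
    have h2 := Finset.card_union_le (Qσ.image (fun i => (C i 0, C i 1)))
      (Qσ.image (fun i => (C i 1, C i 0)))
    have h3 : (Qσ.image (fun i => (C i 0, C i 1))).card ≤ Qσ.card := Finset.card_image_le
    have h4 : (Qσ.image (fun i => (C i 1, C i 0))).card ≤ Qσ.card := Finset.card_image_le
    omega
  have hdisj : ∀ σ ∈ W0, ∀ σ' ∈ W0, σ ≠ σ' →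
      Disjoint (Q.filter (fun i => predSet (C i) σ ⊆ K))
        (Q.filter (fun i => predSet (C i) σ' ⊆ K)) := by
    intro σ hσ σ' hσ' hne
    rw [Finset.disjoint_left]
    intro i hi hi'
    have h1 := (Finset.mem_filter.mp hi).2
    have h2 := (Finset.mem_filter.mp hi').2
    rcases lt_or_gt_of_ne (fun h => hne ((C i).symm.injective h)) with h | h
    · exact hPK σ (hW0P hσ) (h2 (by simpa [predSet] using h))
    · exact hPK σ' (hW0P hσ') (h1 (by simpa [predSet] using h))
  have l1 := hlow σ1 (fun x hx y hy => hK1R x (hK2 (hK3 hx)) y (hK2 (hK3 hy)))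
  have l2 := hlow σ2 (fun x hx y hy => hK2R x (hK3 hx) y (hK3 hy))
  have l3 := hlow σ3 hK3R
  have hunion := Finset.card_le_card (Finset.union_subset (Finset.union_subset
    (Finset.filter_subset (fun i => predSet (C i) σ1 ⊆ K) Q)
    (Finset.filter_subset (fun i => predSet (C i) σ2 ⊆ K) Q))
    (Finset.filter_subset (fun i => predSet (C i) σ3 ⊆ K) Q))
  rw [Finset.card_union_of_disjoint (Finset.disjoint_union_left.mpr
    ⟨hdisj σ1 hσ1 σ3 hσ3 h13, hdisj σ2 hσ2 σ3 hσ3 h23⟩),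
    Finset.card_union_of_disjoint (hdisj σ1 hσ1 σ2 hσ2 h12)] at hunion
  rw [hK3c] at l1 l2 l3 hQle
  have hmul : (2 * ℓ + 6) * (2 * ℓ + 6) - (2 * ℓ + 6) = (2 * ℓ + 6) * (2 * ℓ + 5) := by
    rw [← Nat.mul_sub_one]
    rfl
  rw [hmul] at l1 l2 l3
  nlinarith

theorem eventually_not_exists_suitableCore_even_plus_ell
    (ℓ : ℕ) :
    ∃ s₀ : ℕ, ∀ s : ℕ, s₀ ≤ s →
      ¬ ∃ C : Fin (s * (s + 1) + ℓ) → Equiv.Perm (Fin (s + 3)),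
        IsSuitableCore (s * (s + 1) + ℓ) (s + 3) (2 * s) C := by
  obtain ⟨r₀, h⟩ := main_aux ℓ
  refine ⟨r₀ + 2, ?_⟩
  rintro s hs ⟨C, hC⟩
  obtain ⟨r, rfl⟩ : ∃ r, s = r + 2 := ⟨s - 2, by omega⟩
  exact h r (by omega) C hC
end
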